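/- For every n ≥ 6, every permutation π of [n] contains a pair of tight twins of length at least 2; that is, tt(n) ≥ 2 for all n ≥ 6. -/

import Mathlib

/-- `f` and `g` enumerate (in increasing order of positions) a pair of twins in the
permutation `π`: both are strictly monotone position sequences, with disjoint ranges,
and the two subsequences of `π` are order-isomorphic. -/
def IsTwinPair {n : ℕ} (π : Equiv.Perm (Fin n)) {k : ℕ} (f g : Fin k → Fin n) : Prop :=
  StrictMono f ∧ StrictMono g ∧ (∀ a b : Fin k, f a ≠ g b) ∧
    (∀ a b : Fin k, π (f a) < π (f b) ↔ π (g a) < π (g b))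

/-- `π` contains a pair of twins of length `k`. -/
def HasTwins {n : ℕ} (π : Equiv.Perm (Fin n)) (k : ℕ) : Prop :=
  ∃ f g : Fin k → Fin n, IsTwinPair π f g

/-- `t(π)`: the maximum length of a pair of twins in `π`. -/
noncomputable def twinLen {n : ℕ} (π : Equiv.Perm (Fin n)) : ℕ :=
  sSup {k | HasTwins π k}

/-- The range of `f` is a block (a set of consecutive positions). -/
def IsBlockFun {n k : ℕ} (f : Fin k → Fin n) : Prop :=
  ∃ s : ℕ, ∀ a : Fin k, (f a : ℕ) = s + (a : ℕ)

/-- `π` contains a pair of block twins of length `k`. -/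
def HasBlockTwins {n : ℕ} (π : Equiv.Perm (Fin n)) (k : ℕ) : Prop :=
  ∃ f g : Fin k → Fin n, IsTwinPair π f g ∧ IsBlockFun f ∧ IsBlockFun g

/-- The union of the ranges of `f` and `g` is a block (a set of `2k` consecutive positions). -/
def IsTightPair {n k : ℕ} (f g : Fin k → Fin n) : Prop :=
  ∃ s : ℕ, ∀ x : Fin n,
    ((∃ a, f a = x) ∨ (∃ a, g a = x)) ↔ (s ≤ (x : ℕ) ∧ (x : ℕ) < s + 2 * k)

/-- `π` contains a pair of tight twins of length `k`. -/
def HasTightTwins {n : ℕ} (π : Equiv.Perm (Fin n)) (k : ℕ) : Prop :=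
  ∃ f g : Fin k → Fin n, IsTwinPair π f g ∧ IsTightPair f g

/-- Two pairs of positions, both ascents or both descents of `π`, that together fill a block of
four positions form a pair of tight twins of length `2`. -/
theorem hasTightTwins_two_of_iff {n : ℕ} (π : Equiv.Perm (Fin n)) (s : ℕ) (i j k l : Fin n)
    (hij : i < j) (hkl : k < l) (hik : i ≠ k) (hil : i ≠ l) (hjk : j ≠ k) (hjl : j ≠ l)
    (hblock : ∀ x : Fin n, (x = i ∨ x = j ∨ x = k ∨ x = l) ↔ (s ≤ (x : ℕ) ∧ (x : ℕ) < s + 4))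
    (h : π i < π j ↔ π k < π l) : HasTightTwins π 2 := by
  have hi : π i ≠ π j := fun e => hij.ne (π.injective e)
  have hk : π k ≠ π l := fun e => hkl.ne (π.injective e)
  refine ⟨![i, j], ![k, l], ⟨?_, ?_, ?_, ?_⟩, s, fun x => ?_⟩
  · simpa [Fin.strictMono_iff_lt_succ] using hij
  · simpa [Fin.strictMono_iff_lt_succ] using hkl
  · simp [Fin.forall_fin_two, *]
  · simp only [Fin.forall_fin_two, Matrix.cons_val_zero, Matrix.cons_val_one, lt_irrefl]
    refine ⟨⟨trivial, h⟩, ?_, trivial⟩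
    grind
  · rw [← hblock x]
    simp only [Fin.exists_fin_two, Matrix.cons_val_zero, Matrix.cons_val_one]
    grind

/-- Every block of four positions of a permutation without tight twins of length `2` pairs an
ascent with a descent, in each of the three ways to split it into two pairs. -/
theorem not_iff_of_not_hasTightTwins_two {n : ℕ} (π : Equiv.Perm (Fin n))
    (h : ¬ HasTightTwins π 2) (s : ℕ) (hs : s + 3 < n) :
    ¬ (π ⟨s, by omega⟩ < π ⟨s + 1, by omega⟩ ↔ π ⟨s + 2, by omega⟩ < π ⟨s + 3, hs⟩) ∧
    ¬ (π ⟨s, by omega⟩ < π ⟨s + 2, by omega⟩ ↔ π ⟨s + 1, by omega⟩ < π ⟨s + 3, hs⟩) ∧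
    ¬ (π ⟨s, by omega⟩ < π ⟨s + 3, hs⟩ ↔ π ⟨s + 1, by omega⟩ < π ⟨s + 2, by omega⟩) := by
  refine ⟨fun e => h ?_, fun e => h ?_, fun e => h ?_⟩ <;>
    refine hasTightTwins_two_of_iff π s _ _ _ _ ?_ ?_ ?_ ?_ ?_ ?_ (fun x => ?_) e <;>
    simp only [Fin.ext_iff, Fin.lt_def, ne_eq] <;> omega

/-- For every $n ≥ 6$, every permutation of $[n]$ contains a pair of tight twins of
length $2$; that is, $tt(n) ≥ 2$. -/
theorem tight_twins_lower (n : ℕ) (hn : 6 ≤ n) (π : Equiv.Perm (Fin n)) :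
    HasTightTwins π 2 := by
  by_contra h
  obtain ⟨a₁, a₂, a₃⟩ := not_iff_of_not_hasTightTwins_two π h 0 (by omega)
  obtain ⟨b₁, b₂, b₃⟩ := not_iff_of_not_hasTightTwins_two π h 1 (by omega)
  obtain ⟨c₁, c₂, c₃⟩ := not_iff_of_not_hasTightTwins_two π h 2 (by omega)
  simp only [Nat.reduceAdd, Fin.lt_def] at a₁ a₂ a₃ b₁ b₂ b₃ c₁ c₂ c₃
  omega
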